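/- Let w ∈ S_n be defined by inclusions, let E′(w) = {(p_1,q_1),…,(p_k,q_k)} be enumerated so that r_w(p_1,q_1) ≤ r_w(p_2,q_2) ≤ ⋯ ≤ r_w(p_k,q_k), and for 1 ≤ m ≤ k set R_m = {(x,y) ∈ D(w) : r_w(x,y) > 0, x ≥ p_m, y ≤ q_m, and there is no m′ < m with x ≥ p_{m′} and y ≤ q_{m′}}. Then each R_m is a rectangle, i.e. equals a set of the form {a,…,b} × {c,…,d}, and every box of R_m lies in the connected component of D(w) containing (p_m,q_m). -/

import Mathlib

/-- One-line notation value of a permutation of `Fin n` at a position `k ∈ {1,…,n}`;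
junk value `0` outside that range. -/
def pval {n : ℕ} (w : Equiv.Perm (Fin n)) (k : ℕ) : ℕ :=
  if h : 1 ≤ k ∧ k ≤ n then ((w ⟨k - 1, by omega⟩ : Fin n) : ℕ) + 1 else 0

/-- The rank function `r_w(p,q) = #{k ≤ q : w(k) ≥ p}`. -/
def rk {n : ℕ} (w : Equiv.Perm (Fin n)) (p q : ℕ) : ℕ :=
  ((Finset.Icc 1 n).filter fun k => k ≤ q ∧ p ≤ pval w k).card

/-- The Rothe diagram `D(w) = {(p,q) ∈ {1,…,n}² : w(q) < p and w⁻¹(p) > q}`. -/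
def Diagram {n : ℕ} (w : Equiv.Perm (Fin n)) : Set (ℕ × ℕ) :=
  {pq | 1 ≤ pq.1 ∧ pq.1 ≤ n ∧ 1 ≤ pq.2 ∧ pq.2 ≤ n ∧
    pval w pq.2 < pq.1 ∧ pq.2 < pval w.symm pq.1}

/-- The essential set `E(w)`. -/
def EssSet {n : ℕ} (w : Equiv.Perm (Fin n)) : Set (ℕ × ℕ) :=
  {pq | pq ∈ Diagram w ∧ (pq.1, pq.2 + 1) ∉ Diagram w ∧ (pq.1 - 1, pq.2) ∉ Diagram w}

/-- Condition A at `(p,q)`: there is no `k` with `k ≤ q` and `w(k) ≥ p`. -/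
def CondA {n : ℕ} (w : Equiv.Perm (Fin n)) (p q : ℕ) : Prop :=
  ¬ ∃ k, 1 ≤ k ∧ k ≤ n ∧ k ≤ q ∧ p ≤ pval w k

/-- Condition B at `(p,q)`: there is no `k` with `k > q` and `w(k) < p`. -/
def CondB {n : ℕ} (w : Equiv.Perm (Fin n)) (p q : ℕ) : Prop :=
  ¬ ∃ k, 1 ≤ k ∧ k ≤ n ∧ q < k ∧ pval w k < p

/-- `w` is defined by inclusions if every essential set box satisfies Condition A or B. -/
def DefinedByInclusions {n : ℕ} (w : Equiv.Perm (Fin n)) : Prop :=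
  ∀ p q, (p, q) ∈ EssSet w → CondA w p q ∨ CondB w p q

/-- Two boxes of a set `D ⊆ ℕ × ℕ` are adjacent if both lie in `D`, they agree in one
coordinate and differ by `1` in the other. -/
def AdjIn (D : Set (ℕ × ℕ)) (a b : ℕ × ℕ) : Prop :=
  a ∈ D ∧ b ∈ D ∧
    ((a.1 = b.1 ∧ (a.2 = b.2 + 1 ∨ b.2 = a.2 + 1)) ∨
     (a.2 = b.2 ∧ (a.1 = b.1 + 1 ∨ b.1 = a.1 + 1)))

/-- Two boxes lie in the same connected component of `D` if they are joined by a path of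
adjacent boxes of `D`. -/
def SameComponent (D : Set (ℕ × ℕ)) (a b : ℕ × ℕ) : Prop :=
  Relation.ReflTransGen (AdjIn D) a b

theorem pval_pos {n : ℕ} (w : Equiv.Perm (Fin n)) {k : ℕ} (h₁ : 1 ≤ k) (h₂ : k ≤ n) :
    1 ≤ pval w k := by
  simp [pval, h₁, h₂]

theorem pval_le {n : ℕ} (w : Equiv.Perm (Fin n)) (k : ℕ) : pval w k ≤ n := by
  unfold pval
  split_ifs
  · omega
  · omega

theorem pval_symm_pval {n : ℕ} (w : Equiv.Perm (Fin n)) {k : ℕ} (h₁ : 1 ≤ k) (h₂ : k ≤ n) :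
    pval w.symm (pval w k) = k := by
  have h : pval w k = ((w ⟨k - 1, by omega⟩ : Fin n) : ℕ) + 1 := by simp [pval, h₁, h₂]
  rw [h]
  simp [pval]
  omega

theorem pval_pval_symm {n : ℕ} (w : Equiv.Perm (Fin n)) {k : ℕ} (h₁ : 1 ≤ k) (h₂ : k ≤ n) :
    pval w (pval w.symm k) = k := by
  simpa using pval_symm_pval w.symm h₁ h₂

theorem rk_mono {n : ℕ} (w : Equiv.Perm (Fin n)) {p q x y : ℕ} (hp : p ≤ x) (hq : y ≤ q) :
    rk w x y ≤ rk w p q := by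
  refine Finset.card_le_card fun k hk => ?_
  simp only [Finset.mem_filter] at hk ⊢
  exact ⟨hk.1, by omega, by omega⟩

/-- Moving one box to the right inside the diagram does not change the rank. -/
theorem rk_succ_right {n : ℕ} (w : Equiv.Perm (Fin n)) {x y : ℕ}
    (h : (x, y + 1) ∈ Diagram w) : rk w x (y + 1) = rk w x y := by
  obtain ⟨-, -, -, -, h, -⟩ := h
  unfold rk
  congr 1
  refine Finset.filter_congr fun k _ => ⟨fun ⟨h₁, h₂⟩ => ⟨?_, h₂⟩, fun ⟨h₁, h₂⟩ => ⟨by omega, h₂⟩⟩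
  rcases eq_or_ne k (y + 1) with rfl | hne
  · simp only at h
    omega
  · omega

/-- Moving one box up inside the diagram does not change the rank. -/
theorem rk_pred_up {n : ℕ} (w : Equiv.Perm (Fin n)) {x y : ℕ}
    (h : (x - 1, y) ∈ Diagram w) : rk w (x - 1) y = rk w x y := by
  obtain ⟨h₁, -, -, -, -, h⟩ := h
  simp only at h h₁
  unfold rk
  congr 1
  refine Finset.filter_congr fun k hk => ⟨fun ⟨h₂, h₃⟩ => ⟨h₂, ?_⟩, fun ⟨h₂, h₃⟩ => ⟨h₂, by omega⟩⟩
  rw [Finset.mem_Icc] at hk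
  rcases eq_or_ne (pval w k) (x - 1) with he | hne
  · rw [← he, pval_symm_pval w hk.1 hk.2] at h
    omega
  · omega

/-- Every diagram box has an essential box of the same rank weakly to its north-east. -/
theorem exists_essSet_rk_eq {n : ℕ} (w : Equiv.Perm (Fin n)) {x y : ℕ}
    (h : (x, y) ∈ Diagram w) :
    ∃ p q, (p, q) ∈ EssSet w ∧ p ≤ x ∧ y ≤ q ∧ rk w p q = rk w x y := by
  induction hs : x + (n - y) using Nat.strong_induction_on generalizing x y with
  | _ s ih =>
    by_cases hr : (x, y + 1) ∈ Diagram w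
    · have hy : y + 1 ≤ n := hr.2.2.2.1
      obtain ⟨p, q, he, hp, hq, hk⟩ := ih (x + (n - (y + 1))) (by omega) hr rfl
      exact ⟨p, q, he, hp, by omega, hk.trans (rk_succ_right w hr)⟩
    by_cases hu : (x - 1, y) ∈ Diagram w
    · have hx : 1 ≤ x - 1 := hu.1
      obtain ⟨p, q, he, hp, hq, hk⟩ := ih (x - 1 + (n - y)) (by omega) hu rfl
      exact ⟨p, q, he, by omega, hq, hk.trans (rk_pred_up w hu)⟩
    exact ⟨x, y, ⟨h, hr, hu⟩, le_rfl, le_rfl, rfl⟩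

/-- Under Condition B the rank is determined by the position. -/
theorem CondB.rk_add {n : ℕ} {w : Equiv.Perm (Fin n)} {p q : ℕ} (h : CondB w p q)
    (hp₁ : 1 ≤ p) (hp : p ≤ n) (hq : q ≤ n) : rk w p q + p = q + 1 := by
  have hrk : rk w p q = ((Finset.Icc 1 q).filter fun k => p ≤ pval w k).card := by
    unfold rk
    congr 1
    ext k
    simp only [Finset.mem_filter, Finset.mem_Icc]
    omega
  have hlt : ((Finset.Icc 1 q).filter fun k => ¬ p ≤ pval w k).card = p - 1 := by
    have : p - 1 = (Finset.Icc 1 (p - 1)).card := by simp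
    rw [this]
    refine Finset.card_nbij' (pval w) (pval w.symm) ?_ ?_ ?_ ?_
    · intro k hk
      simp only [Finset.coe_filter, Finset.mem_Icc, Set.mem_ofPred_eq, Finset.coe_Icc,
        Set.mem_Icc] at hk ⊢
      exact ⟨pval_pos w hk.1.1 (by omega), by omega⟩
    · intro v hv
      simp only [Finset.coe_filter, Finset.mem_Icc, Set.mem_ofPred_eq, Finset.coe_Icc,
        Set.mem_Icc] at hv ⊢
      have hw := pval_pval_symm w hv.1 (show v ≤ n by omega)
      have h1 := pval_pos w.symm hv.1 (show v ≤ n by omega)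
      refine ⟨⟨h1, ?_⟩, by omega⟩
      by_contra hlt
      exact h ⟨_, h1, pval_le _ _, by omega, by omega⟩
    · intro k hk
      simp only [Finset.coe_filter, Finset.mem_Icc, Set.mem_ofPred_eq] at hk
      exact pval_symm_pval w hk.1.1 (by omega)
    · intro v hv
      simp only [Finset.coe_Icc, Set.mem_Icc] at hv
      exact pval_pval_symm w hv.1 (by omega)
  have := Finset.card_filter_add_card_filter_not (s := Finset.Icc 1 q) (fun k => p ≤ pval w k)
  rw [← hrk, hlt, Nat.card_Icc] at this
  omega

/-- South-west of `(p, q)`, the diagram boxes of the same rank as `(p, q)` are those for which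
every dot weakly south-west of `(p, q)` is strictly south-west of the box. -/
theorem mem_diagram_and_rk_eq_iff {n : ℕ} (w : Equiv.Perm (Fin n)) {p q x y : ℕ}
    (hp₁ : 1 ≤ p) (hq : q ≤ n) (hx : p ≤ x) (hy : y ≤ q) :
    ((x, y) ∈ Diagram w ∧ rk w x y = rk w p q) ↔
      x ≤ n ∧ 1 ≤ y ∧ ∀ k, 1 ≤ k → k ≤ q → p ≤ pval w k → k < y ∧ x < pval w k := by
  constructor
  · rintro ⟨⟨-, h₂, h₃, -, h₅, h₆⟩, hr⟩
    simp only at h₂ h₃ h₅ h₆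
    refine ⟨h₂, h₃, fun k hk₁ hkq hkp => ?_⟩
    have hsub : ((Finset.Icc 1 n).filter fun k => k ≤ y ∧ x ≤ pval w k) ⊆
        (Finset.Icc 1 n).filter fun k => k ≤ q ∧ p ≤ pval w k := by
      intro j hj
      simp only [Finset.mem_filter] at hj ⊢
      exact ⟨hj.1, by omega, by omega⟩
    have heq := Finset.eq_of_subset_of_card_le hsub hr.ge
    have hmem : k ∈ (Finset.Icc 1 n).filter fun k => k ≤ q ∧ p ≤ pval w k := by
      simp only [Finset.mem_filter, Finset.mem_Icc]
      omega
    rw [← heq] at hmem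
    simp only [Finset.mem_filter] at hmem
    obtain ⟨-, hky, hkx⟩ := hmem
    refine ⟨lt_of_le_of_ne hky ?_, lt_of_le_of_ne hkx ?_⟩
    · rintro rfl
      omega
    · rintro rfl
      rw [pval_symm_pval w hk₁ (by omega)] at h₆
      omega
  · rintro ⟨hxn, hy₁, h⟩
    refine ⟨⟨by omega, hxn, hy₁, by omega, ?_, ?_⟩, le_antisymm (rk_mono w hx hy) ?_⟩
    · by_contra hc
      simp only at hc
      exact absurd (h y hy₁ hy (by omega)).1 (lt_irrefl _)
    · by_contra hc
      simp only at hc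
      have hv := pval_pval_symm w (show 1 ≤ x by omega) hxn
      have := h _ (pval_pos w.symm (show 1 ≤ x by omega) hxn) (by omega) (by omega)
      omega
    · refine Finset.card_le_card fun k hk => ?_
      simp only [Finset.mem_filter, Finset.mem_Icc] at hk ⊢
      have := h k hk.1.1 hk.2.1 hk.2.2
      omega

/-- A box is joined to the north-east corner of any rectangle in `D` of which it is the
south-west corner. -/
theorem SameComponent.of_rectangle {D : Set (ℕ × ℕ)} {p q x y : ℕ} (hx : p ≤ x) (hy : y ≤ q)
    (h : ∀ x' y', p ≤ x' → x' ≤ x → y ≤ y' → y' ≤ q → (x', y') ∈ D) :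
    SameComponent D (x, y) (p, q) := by
  have hup : SameComponent D (x, y) (p, y) := by
    induction x, hx using Nat.le_induction with
    | base => exact Relation.ReflTransGen.refl
    | succ x hx ih =>
      refine Relation.ReflTransGen.head ⟨h _ _ (by omega) le_rfl le_rfl hy,
        h x y hx (by omega) le_rfl hy, Or.inr ⟨rfl, Or.inl rfl⟩⟩
        (ih fun x' y' h₁ h₂ h₃ h₄ => h x' y' h₁ (by omega) h₃ h₄)
  have hright : SameComponent D (p, y) (p, q) := by
    induction q, hy using Nat.le_induction with
    | base => exact Relation.ReflTransGen.refl
    | succ q hy ih =>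
      exact Relation.ReflTransGen.tail (ih fun x' y' h₁ h₂ h₃ h₄ => h x' y' h₁ h₂ h₃ (by omega))
        ⟨h p q le_rfl hx hy (by omega), h p _ le_rfl hx (by omega) le_rfl,
          Or.inl ⟨rfl, Or.inr rfl⟩⟩
  exact hup.trans hright

/-- A set of boxes south-west of `(p, q)` is a rectangle if its rows are bounded, it contains the
whole rectangle between each of its boxes and `(p, q)`, and it contains the south-west corner of
the rectangle spanned by any two of its boxes. -/
theorem exists_eq_Icc_prod_Icc {R : Set (ℕ × ℕ)} {p q n : ℕ}
    (hsw : ∀ x y, (x, y) ∈ R → p ≤ x ∧ x ≤ n ∧ y ≤ q)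
    (hne : ∀ x y x' y', (x, y) ∈ R → p ≤ x' → x' ≤ x → y ≤ y' → y' ≤ q → (x', y') ∈ R)
    (hcorner : ∀ x y x' y', (x, y) ∈ R → (x', y') ∈ R → x' ≤ x → y' ≤ y → (x, y') ∈ R) :
    ∃ a b c d : ℕ, R = Set.Icc a b ×ˢ Set.Icc c d := by
  classical
  rcases R.eq_empty_or_nonempty with rfl | ⟨⟨x₀, y₀⟩, h₀⟩
  · exact ⟨1, 0, 1, 0, by simp⟩
  have hrow : ∃ x y, (x, y) ∈ R ∧ ∀ x' y', (x', y') ∈ R → x' ≤ x := by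
    have hP : ∃ y, (x₀, y) ∈ R := ⟨y₀, h₀⟩
    obtain ⟨y, hy⟩ := Nat.findGreatest_spec (P := fun x => ∃ y, (x, y) ∈ R) (hsw _ _ h₀).2.1 hP
    exact ⟨_, y, hy, fun x' y' h' => Nat.le_findGreatest (hsw _ _ h').2.1 ⟨y', h'⟩⟩
  have hcol : ∃ y x, (x, y) ∈ R ∧ ∀ x' y', (x', y') ∈ R → y ≤ y' := by
    have hP : ∃ y x, (x, y) ∈ R := ⟨y₀, x₀, h₀⟩
    obtain ⟨x, hx⟩ := Nat.find_spec hP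
    exact ⟨_, x, hx, fun x' y' h' => Nat.find_min' hP ⟨x', h'⟩⟩
  obtain ⟨b, y, hb, hbmax⟩ := hrow
  obtain ⟨c, x, hc, hcmin⟩ := hcol
  have hbc : (b, c) ∈ R := hcorner _ _ _ _ hb hc (hbmax _ _ hc) (hcmin _ _ hb)
  refine ⟨p, b, c, q, Set.ext fun ⟨u, v⟩ => ⟨fun h => ?_, fun h => ?_⟩⟩
  · exact ⟨⟨(hsw _ _ h).1, hbmax _ _ h⟩, hcmin _ _ h, (hsw _ _ h).2.2⟩
  · exact hne _ _ _ _ hbc h.1.1 h.1.2 h.2.1 h.2.2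

/-- Let `w` be defined by inclusions, let `(p_1,q_1),…,(p_k,q_k)` enumerate the boxes of
`E′(w)` (the essential boxes of positive rank) in weakly increasing order of rank, and let
`R_m` consist of the positive-rank diagram boxes weakly SW of `(p_m,q_m)` but not weakly SW
of any earlier `(p_{m′},q_{m′})`.  Then `R_m` is a rectangle all of whose boxes lie in the
connected component of `D(w)` containing `(p_m,q_m)`. -/
theorem region_is_rectangle_in_component {n : ℕ} (w : Equiv.Perm (Fin n))
    (hw : DefinedByInclusions w) (k : ℕ) (e : Fin k → ℕ × ℕ)
    (hinj : Function.Injective e)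
    (hrange : Set.range e = {pq | pq ∈ EssSet w ∧ 0 < rk w pq.1 pq.2})
    (hsort : ∀ i j : Fin k, i ≤ j → rk w (e i).1 (e i).2 ≤ rk w (e j).1 (e j).2)
    (m : Fin k) (R : Set (ℕ × ℕ))
    (hR : R = {xy | xy ∈ Diagram w ∧ 0 < rk w xy.1 xy.2 ∧
      (e m).1 ≤ xy.1 ∧ xy.2 ≤ (e m).2 ∧
      ¬ ∃ m' : Fin k, m' < m ∧ (e m').1 ≤ xy.1 ∧ xy.2 ≤ (e m').2}) :
    (∃ a b c d : ℕ, R = Set.Icc a b ×ˢ Set.Icc c d) ∧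
      ∀ xy ∈ R, SameComponent (Diagram w) xy (e m) := by
  have hmem : ∀ i, e i ∈ EssSet w ∧ 0 < rk w (e i).1 (e i).2 := fun i => by
    have : e i ∈ Set.range e := ⟨i, rfl⟩
    rwa [hrange] at this
  have hrk : ∀ i, rk w (e i).1 (e i).2 + (e i).1 = (e i).2 + 1 := fun i => by
    obtain ⟨he, hpos⟩ := hmem i
    obtain ⟨h₁, h₂, -, h₄, -, -⟩ := he.1
    rcases hw _ _ he with hA | hB
    · obtain ⟨k, hk⟩ := Finset.card_pos.1 hpos
      simp only [Finset.mem_filter, Finset.mem_Icc] at hk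
      exact absurd ⟨k, hk.1.1, hk.1.2, hk.2.1, hk.2.2⟩ hA
    · exact hB.rk_add h₁ h₂ h₄
  obtain ⟨hp₁, -, -, hqn, -, -⟩ := (hmem m).1.1
  have hpos := (hmem m).2
  have hRiff : ∀ x y, (x, y) ∈ R ↔ (e m).1 ≤ x ∧ y ≤ (e m).2 ∧
      (x ≤ n ∧ 1 ≤ y ∧ ∀ k, 1 ≤ k → k ≤ (e m).2 → (e m).1 ≤ pval w k → k < y ∧ x < pval w k) ∧
      ∀ i < m, (e i).1 ≤ x → ¬ y ≤ (e i).2 := by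
    intro x y
    rw [hR]
    constructor
    · rintro ⟨hD, hr, hx, hy, hno⟩
      simp only at hr hx hy hno
      refine ⟨hx, hy, (mem_diagram_and_rk_eq_iff w hp₁ hqn hx hy).1 ⟨hD, ?_⟩,
        fun i hi h₁ h₂ => hno ⟨i, hi, h₁, h₂⟩⟩
      obtain ⟨p', q', he, hp', hq', hk⟩ := exists_essSet_rk_eq w hD
      have hE : (p', q') ∈ Set.range e := by
        rw [hrange]
        exact ⟨he, hk ▸ hr⟩
      obtain ⟨i, hi⟩ := hE
      have hmi : m ≤ i := by
        by_contra hlt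
        exact hno ⟨i, not_le.1 hlt, by simpa [hi] using hp', by simpa [hi] using hq'⟩
      have := hsort m i hmi
      rw [hi] at this
      exact le_antisymm (rk_mono w hx hy) (this.trans hk.le)
    · rintro ⟨hx, hy, hgood, hno⟩
      obtain ⟨hD, hr⟩ := (mem_diagram_and_rk_eq_iff w hp₁ hqn hx hy).2 hgood
      exact ⟨hD, hr ▸ hpos, hx, hy, fun ⟨i, hi, h₁, h₂⟩ => hno i hi h₁ h₂⟩
  have hne : ∀ x y x' y', (x, y) ∈ R → (e m).1 ≤ x' → x' ≤ x → y ≤ y' → y' ≤ (e m).2 →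
      (x', y') ∈ R := by
    intro x y x' y' h h₁ h₂ h₃ h₄
    obtain ⟨-, -, ⟨hxn, hy₁, hgood⟩, hno⟩ := (hRiff x y).1 h
    refine (hRiff x' y').2 ⟨h₁, h₄, ⟨by omega, by omega, fun k hk₁ hkq hkp => ?_⟩,
      fun i hi hip hiq => hno i hi (by omega) (by omega)⟩
    have := hgood k hk₁ hkq hkp
    omega
  refine ⟨exists_eq_Icc_prod_Icc (p := (e m).1) (q := (e m).2) (n := n) ?_ hne ?_, ?_⟩
  · intro x y h
    obtain ⟨hx, hy, ⟨hxn, -, -⟩, -⟩ := (hRiff x y).1 h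
    exact ⟨hx, hxn, hy⟩
  · intro x y x' y' h h' hx hy
    obtain ⟨hpx, hyq, ⟨hxn, hy₁, hgood⟩, hno⟩ := (hRiff x y).1 h
    obtain ⟨hpx', hyq', ⟨hxn', hy₁', hgood'⟩, hno'⟩ := (hRiff x' y').1 h'
    have hcorner : x ≤ n ∧ 1 ≤ y' ∧
        ∀ k, 1 ≤ k → k ≤ (e m).2 → (e m).1 ≤ pval w k → k < y' ∧ x < pval w k :=
      ⟨hxn, hy₁', fun k h₁ h₂ h₃ => ⟨(hgood' k h₁ h₂ h₃).1, (hgood k h₁ h₂ h₃).2⟩⟩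
    refine (hRiff x y').2 ⟨hpx, hyq', hcorner, fun i hi hip hiq => ?_⟩
    have hr := ((mem_diagram_and_rk_eq_iff w hp₁ hqn hpx hyq').2 hcorner).2
    have hle := rk_mono w hip hiq
    have hge := hsort i m hi.le
    have hm := hrk m
    have hi' := hrk i
    have := hno i hi hip
    have := hno' i hi
    omega
  · rintro ⟨x, y⟩ h
    obtain ⟨hpx, hyq, -, -⟩ := (hRiff x y).1 h
    refine SameComponent.of_rectangle hpx hyq fun x' y' h₁ h₂ h₃ h₄ => ?_
    have := hne x y x' y' h h₁ h₂ h₃ h₄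
    rw [hR] at this
    exact this.1
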